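/- Let 𝓓 = (Ω, 𝓑) be a simple pliable 4-hypergraph with |Ω| ≥ 4 in which any two distinct points are collinear. Then the following are equivalent: (a) the hole stabilizer π_∞(𝓓) is trivial for every ∞ ∈ Ω; (b) there exist k ≥ 2 and a bijection Ω → F_2^k carrying the lines of 𝓑 exactly onto the lines of the Boolean quadruple system of order 2^k (i.e. onto the 4-element subsets of F_2^k whose elements sum to 0). -/

import Mathlib

open Equiv

variable {Ω : Type*} [DecidableEq Ω] [Fintype Ω]

/-- Two points of a 4-hypergraph are collinear if they are equal or some line contains both. -/
def HGCollinear (B : Finset (Finset Ω)) (x y : Ω) : Prop :=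
  x = y ∨ ∃ b ∈ B, x ∈ b ∧ y ∈ b

/-- A 4-hypergraph is pliable if any two lines sharing three pairwise distinct points are equal. -/
def HGPliable (B : Finset (Finset Ω)) : Prop :=
  ∀ b₁ ∈ B, ∀ b₂ ∈ B, ∀ p q r : Ω, p ≠ q → p ≠ r → q ≠ r →
    p ∈ b₁ → q ∈ b₁ → r ∈ b₁ → p ∈ b₂ → q ∈ b₂ → r ∈ b₂ → b₁ = b₂

/-- `g` is the elementary move `[x,y]`: it interchanges `x` and `y`, interchanges the
remaining two points of every line through `x` and `y`, and fixes everything else.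
For `x = y` it is the identity. -/
def IsElemMove (B : Finset (Finset Ω)) (x y : Ω) (g : Equiv.Perm Ω) : Prop :=
  (x = y ∧ g = 1) ∨
  (x ≠ y ∧ (∃ b ∈ B, x ∈ b ∧ y ∈ b) ∧ g x = y ∧ g y = x ∧
    ∀ z : Ω, z ≠ x → z ≠ y →
      ((∀ b ∈ B, ¬(x ∈ b ∧ y ∈ b ∧ z ∈ b)) → g z = z) ∧
      (∀ b ∈ B, x ∈ b → y ∈ b → z ∈ b →
        ∀ w ∈ b, w ≠ x → w ≠ y → w ≠ z → g z = w))

/-- `g` is the move sequence `[a₀,…,a_k]` recorded by the list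
(elementary moves applied left to right). -/
def IsMoveSeq (B : Finset (Finset Ω)) : List Ω → Equiv.Perm Ω → Prop
  | [], _ => False
  | [_], g => g = 1
  | a :: b :: l, g => ∃ e h : Equiv.Perm Ω,
      IsElemMove B a b e ∧ IsMoveSeq B (b :: l) h ∧ g = h * e

/-- The puzzle set `𝓛_𝓓` of all move sequences. -/
def puzzleSet (B : Finset (Finset Ω)) : Set (Equiv.Perm Ω) :=
  { g | ∃ l : List Ω, IsMoveSeq B l g }

/-- The hole stabiliser `π_x(𝓓)`: all closed move sequences starting and ending at `x`. -/
def holeStab (B : Finset (Finset Ω)) (x : Ω) : Set (Equiv.Perm Ω) :=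
  { g | ∃ l : List Ω, l.head? = some x ∧ l.getLast? = some x ∧ IsMoveSeq B l g }

/-- `(Ω, B)` is a 2-(n,4,λ) design: lines have four points and every pair of distinct
points lies in exactly `lam` lines. -/
def IsTwoDesign (B : Finset (Finset Ω)) (lam : ℕ) : Prop :=
  (∀ b ∈ B, b.card = 4) ∧
  ∀ p q : Ω, p ≠ q → (B.filter fun b => p ∈ b ∧ q ∈ b).card = lam

/-- Supersimple: any two distinct lines meet in at most two points. -/
def HGSupersimple (B : Finset (Finset Ω)) : Prop :=
  ∀ b₁ ∈ B, ∀ b₂ ∈ B, b₁ ≠ b₂ → (b₁ ∩ b₂).card ≤ 2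

/-- `x ∈ overline{a,c}`: `x` is `a`, `c`, or lies on a line containing both `a` and `c`. -/
def HGLineClosure (B : Finset (Finset Ω)) (a c x : Ω) : Prop :=
  x = a ∨ x = c ∨ ∃ b ∈ B, a ∈ b ∧ c ∈ b ∧ x ∈ b

/-- A system of imprimitivity for the hole stabiliser `π_x` acting on `Ω \ {x}`,
with `ℓ` blocks each of size `k`. -/
def IsHoleBlockSystem (B : Finset (Finset Ω)) (x : Ω) (P : Finset (Finset Ω))
    (k ℓ : ℕ) : Prop :=
  P.card = ℓ ∧ 1 < k ∧ 1 < ℓ ∧ (∀ Δ ∈ P, Δ.card = k) ∧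
  (∀ a : Ω, a ≠ x → ∃! Δ : Finset Ω, Δ ∈ P ∧ a ∈ Δ) ∧
  (∀ Δ ∈ P, x ∉ Δ) ∧
  (∀ g ∈ holeStab B x, ∀ Δ ∈ P, Δ.image (⇑g) ∈ P)

/-- In a pliable 4-hypergraph, every pair of collinear points has an elementary move. -/
theorem HGPliable.exists_isElemMove {B : Finset (Finset Ω)} (hpl : HGPliable B)
    (hlines : ∀ b ∈ B, b.card = 4) {x y : Ω} (hxy : HGCollinear B x y) :
    ∃ g : Equiv.Perm Ω, IsElemMove B x y g := by
  classical
  rcases eq_or_ne x y with h | hne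
  · exact ⟨1, Or.inl ⟨h, rfl⟩⟩
  have hb := hxy.resolve_left hne
  let R : Ω → Ω → Prop := fun z w =>
    z ≠ x ∧ z ≠ y ∧ w ≠ x ∧ w ≠ y ∧ w ≠ z ∧ ∃ b ∈ B, x ∈ b ∧ y ∈ b ∧ z ∈ b ∧ w ∈ b
  have hsymm : ∀ {z w}, R z w → R w z := fun ⟨h1, h2, h3, h4, h5, b, hb, h6, h7, h8, h9⟩ =>
    ⟨h3, h4, h1, h2, h5.symm, b, hb, h6, h7, h9, h8⟩
  have hfun : ∀ {z w w'}, R z w → R z w' → w = w' := by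
    rintro z w w' ⟨h1, h2, h3, h4, h5, b, hb, h6, h7, h8, h9⟩
      ⟨-, -, k3, k4, k5, c, hc, k6, k7, k8, k9⟩
    obtain rfl := hpl b hb c hc x y z hne h1.symm h2.symm h6 h7 h8 k6 k7 k8
    by_contra hw
    have hsub : ({x, y, z, w, w'} : Finset Ω) ⊆ b := by
      simp [Finset.insert_subset_iff, *]
    have hcard := Finset.card_le_card hsub
    have hne5 : ({x, y, z, w, w'} : Finset Ω).card = 5 := by
      simp [hne, h1.symm, h2.symm, h3.symm, h4.symm, h5.symm, k3.symm, k4.symm, k5.symm, hw]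
    rw [hlines b hb, hne5] at hcard
    omega
  let f : Ω → Ω := fun z =>
    if z = x then y else if z = y then x else if h : ∃ w, R z w then h.choose else z
  have hfx : f x = y := by simp [f]
  have hfy : f y = x := by simp [f, hne.symm]
  have hfR : ∀ {z w}, R z w → f z = w := by
    intro z w h
    have hex : ∃ w, R z w := ⟨w, h⟩
    simp only [f, h.1, h.2.1, if_false, dif_pos hex]
    exact hfun hex.choose_spec h
  have hfz : ∀ {z}, z ≠ x → z ≠ y → (¬ ∃ w, R z w) → f z = z := by
    intro z h1 h2 h3
    simp only [f, h1, h2, if_false, dif_neg h3]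
  have hinv : Function.Involutive f := by
    intro z
    rcases eq_or_ne z x with rfl | h1
    · rw [hfx, hfy]
    rcases eq_or_ne z y with rfl | h2
    · rw [hfy, hfx]
    by_cases h : ∃ w, R z w
    · obtain ⟨w, hw⟩ := h
      rw [hfR hw, hfR (hsymm hw)]
    · rw [hfz h1 h2 h, hfz h1 h2 h]
  refine ⟨hinv.toPerm f, Or.inr ⟨hne, hb, hfx, hfy, fun z h1 h2 => ⟨fun h => ?_, ?_⟩⟩⟩
  · refine hfz h1 h2 ?_
    rintro ⟨w, -, -, -, -, -, b, hb, h6, h7, h8, -⟩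
    exact h b hb ⟨h6, h7, h8⟩
  · intro b hb h6 h7 h8 w h9 h3 h4 h5
    exact hfR ⟨h1, h2, h3, h4, h5, b, hb, h6, h7, h8, h9⟩

omit [DecidableEq Ω] [Fintype Ω] in
theorem IsElemMove.symm {B : Finset (Finset Ω)} {x y : Ω} {g : Equiv.Perm Ω}
    (h : IsElemMove B x y g) : IsElemMove B y x g := by
  rcases h with ⟨h, hg⟩ | ⟨hne, ⟨b, hb, hx, hy⟩, hgx, hgy, h⟩
  · exact Or.inl ⟨h.symm, hg⟩
  · refine Or.inr ⟨hne.symm, ⟨b, hb, hy, hx⟩, hgy, hgx, fun z hzy hzx => ⟨fun hz => ?_, ?_⟩⟩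
    · exact (h z hzx hzy).1 fun c hc hm => hz c hc ⟨hm.2.1, hm.1, hm.2.2⟩
    · intro c hc hyc hxc hzc w hw hwy hwx hwz
      exact (h z hzx hzy).2 c hc hxc hyc hzc w hw hwx hwy hwz

omit [DecidableEq Ω] [Fintype Ω] in
theorem IsElemMove.apply_left {B : Finset (Finset Ω)} {x y : Ω} {g : Equiv.Perm Ω}
    (h : IsElemMove B x y g) : g x = y := by
  rcases h with ⟨rfl, rfl⟩ | ⟨-, -, hgx, -⟩
  · rfl
  · exact hgx

/-- Commuting involutions `t a`, each moving a base point to `a`, are the translations of an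
elementary abelian 2-group. -/
theorem exists_equiv_of_commuting_involutions {α : Type*} [Finite α] (o : α)
    (t : α → Equiv.Perm α) (ht : ∀ a, t a o = a) (hcomm : ∀ a b, t a * t b = t b * t a)
    (hsq : ∀ a, t a * t a = 1) :
    ∃ (k : ℕ) (e : α ≃ (Fin k → ZMod 2)), ∀ a b, e (t a b) = e a + e b := by
  have happ : ∀ a b c, t a (t b c) = t b (t a c) := fun a b c =>
    DFunLike.congr_fun (hcomm a b) c
  have hinv : ∀ a b, t a (t a b) = b := fun a b => DFunLike.congr_fun (hsq a) b
  have hc : ∀ a b, t a b = t b a := fun a b => by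
    simpa only [ht] using happ a b o
  have ho : ∀ a, t o a = a := fun a => by rw [hc, ht]
  let _ : Add α := ⟨fun a b => t a b⟩
  let _ : Zero α := ⟨o⟩
  let _ : Neg α := ⟨fun a => a⟩
  let _ : AddCommGroup α :=
    { add_assoc := fun a b c => by
        change t (t a b) c = t a (t b c)
        rw [hc, happ, hc c b]
      zero_add := ho
      add_zero := ht
      neg_add_cancel := fun a => by
        change t a a = o
        simpa only [ht] using hinv a o
      add_comm := hc
      nsmul := nsmulRec
      zsmul := zsmulRec }
  have htwo : ∀ a : α, 2 • a = 0 := fun a => by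
    rw [two_nsmul]
    exact neg_add_cancel a
  let _ : Module (ZMod 2) α := AddCommGroup.zmodModule htwo
  let φ := Module.finBasis (ZMod 2) α
  exact ⟨_, φ.equivFun.toEquiv, fun a b => map_add φ.equivFun a b⟩

omit [Fintype Ω] in
/-- In a Boolean quadruple system, elementary moves are translations. -/
theorem IsElemMove.apply_of_boolean {B : Finset (Finset Ω)} {V : Type*} [AddCommGroup V]
    (htwo : ∀ v : V, v + v = 0) (e : Ω ≃ V)
    (he : ∀ s : Finset Ω, s ∈ B ↔ (s.card = 4 ∧ ∑ p ∈ s, e p = 0))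
    {x y : Ω} {g : Equiv.Perm Ω} (hg : IsElemMove B x y g) (z : Ω) :
    e (g z) = e z + (e x + e y) := by
  rcases hg with ⟨rfl, rfl⟩ | ⟨hne, -, hgx, hgy, hg⟩
  · simp [htwo]
  rcases eq_or_ne z x with rfl | hzx
  · rw [hgx, ← add_assoc, htwo, zero_add]
  rcases eq_or_ne z y with rfl | hzy
  · rw [hgy, add_comm (e x), ← add_assoc, htwo, zero_add]
  obtain ⟨w, hw⟩ := e.surjective (e z + (e x + e y))
  have hneg : ∀ v : V, -v = v := fun v => neg_eq_of_add_eq_zero_left (htwo v)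
  have hcancel : ∀ u v : V, u + v = 0 → u = v := fun u v h => by
    rw [eq_neg_of_add_eq_zero_left h, hneg]
  have hwx : w ≠ x := by
    rintro rfl
    refine hzy (e.injective (hcancel _ _ ?_))
    rw [add_left_comm] at hw
    exact left_eq_add.mp hw
  have hwy : w ≠ y := by
    rintro rfl
    refine hzx (e.injective (hcancel _ _ ?_))
    rw [← add_assoc] at hw
    exact right_eq_add.mp hw
  have hwz : w ≠ z := by
    rintro rfl
    exact hne (e.injective (hcancel _ _ (left_eq_add.mp hw)))
  have hmem : ({x, y, z, w} : Finset Ω) ∈ B := by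
    rw [he]
    constructor
    · simp [hne, hzx.symm, hzy.symm, hwx.symm, hwy.symm, hwz.symm]
    · rw [Finset.sum_insert (by simp [hne, hzx.symm, hwx.symm]),
        Finset.sum_insert (by simp [hzy.symm, hwy.symm]), Finset.sum_pair hwz.symm, hw,
        ← add_assoc (e z), htwo, zero_add, ← add_assoc, htwo]
  rw [(hg z hzx hzy).2 _ hmem (by simp) (by simp) (by simp) w (by simp) hwx hwy hwz, hw]

omit [Fintype Ω] in
theorem IsMoveSeq.apply_of_boolean {B : Finset (Finset Ω)} {V : Type*} [AddCommGroup V]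
    (htwo : ∀ v : V, v + v = 0) (e : Ω ≃ V)
    (he : ∀ s : Finset Ω, s ∈ B ↔ (s.card = 4 ∧ ∑ p ∈ s, e p = 0))
    {l : List Ω} {x y : Ω} {g : Equiv.Perm Ω} (hx : l.head? = some x) (hy : l.getLast? = some y)
    (hg : IsMoveSeq B l g) (z : Ω) :
    e (g z) = e z + (e x + e y) := by
  induction l generalizing x g z with
  | nil => simp at hx
  | cons a l ih =>
    obtain rfl : a = x := by simpa using hx
    cases l with
    | nil =>
      obtain rfl : a = y := by simpa using hy
      obtain rfl : g = 1 := hg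
      simp [htwo]
    | cons b l =>
      obtain ⟨m, h, hm, hh, rfl⟩ := hg
      rw [Equiv.Perm.mul_apply, ih (x := b) rfl (by simpa using hy) hh,
        hm.apply_of_boolean htwo e he]
      calc e z + (e a + e b) + (e b + e y) = e z + (e a + e y) + (e b + e b) := by abel
        _ = _ := by rw [htwo, add_zero]

omit [Fintype Ω] in
/-- A hypergraph isomorphic to a Boolean quadruple system has trivial hole stabilizers. -/
theorem holeStab_eq_of_boolean {B : Finset (Finset Ω)} {V : Type*} [AddCommGroup V]
    (htwo : ∀ v : V, v + v = 0) (e : Ω ≃ V)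
    (he : ∀ s : Finset Ω, s ∈ B ↔ (s.card = 4 ∧ ∑ p ∈ s, e p = 0)) (x : Ω) :
    holeStab B x = {1} := by
  refine Set.Subset.antisymm ?_ ?_
  · rintro g ⟨l, hx, hy, hg⟩
    refine Equiv.ext fun z => e.injective ?_
    rw [hg.apply_of_boolean htwo e he hx hy, htwo, add_zero]
    rfl
  · rintro _ rfl
    exact ⟨[x], rfl, rfl, rfl⟩

omit [DecidableEq Ω] in
/-- If all hole stabilizers are trivial, then the elementary moves are the translations of an
elementary abelian 2-group. -/
theorem exists_equiv_of_holeStab_eq [Nonempty Ω] {B : Finset (Finset Ω)}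
    (M : Ω → Ω → Equiv.Perm Ω) (hM : ∀ x y, IsElemMove B x y (M x y))
    (hst : ∀ x : Ω, holeStab B x = {1}) :
    ∃ (k : ℕ) (e : Ω ≃ (Fin k → ZMod 2)), ∀ x y z, e (M x y z) = e x + e y + e z := by
  have hone : ∀ {x : Ω} {g : Equiv.Perm Ω}, g ∈ holeStab B x → g = 1 := fun {x g} h => by
    rwa [hst x] at h
  have htwo : ∀ {x y : Ω} {g h : Equiv.Perm Ω},
      IsElemMove B x y g → IsElemMove B y x h → h * g = 1 := fun {x y g h} hg hh =>
    hone (x := x) ⟨[x, y, x], rfl, rfl, g, h, hg, ⟨h, 1, hh, rfl, (one_mul h).symm⟩, rfl⟩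
  have hsq : ∀ x y, M x y * M x y = 1 := fun x y => htwo (hM x y) (hM x y).symm
  have hsymm : ∀ x y, M x y = M y x := fun x y =>
    mul_left_cancel ((hsq x y).trans (htwo (hM y x) (hM x y)).symm)
  have htri : ∀ x y z, M y z * M x y = M x z := fun x y z => by
    have h : M z x * M y z * M x y = 1 := hone (x := x)
      ⟨[x, y, z, x], rfl, rfl, M x y, M z x * M y z, hM x y,
        ⟨M y z, M z x, hM y z, ⟨M z x, 1, hM z x, rfl, (one_mul _).symm⟩, rfl⟩, rfl⟩
    rw [hsymm z x, mul_assoc] at h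
    exact mul_left_cancel (h.trans (hsq x z).symm)
  let o : Ω := Classical.arbitrary Ω
  have hMo : ∀ x y, M o y * M o x = M x y := fun x y => by rw [hsymm o x, htri]
  obtain ⟨k, e, he⟩ := exists_equiv_of_commuting_involutions o (M o)
    (fun a => (hM o a).apply_left) (fun a b => by rw [hMo, hMo, hsymm]) (hsq o)
  refine ⟨k, e, fun x y z => ?_⟩
  rw [← hMo, Equiv.Perm.mul_apply, he, he]
  abel

omit [Fintype Ω] in
/-- If elementary moves are translations, the lines are those of a Boolean quadruple system. -/
theorem mem_iff_of_isElemMove_apply {B : Finset (Finset Ω)} (hlines : ∀ b ∈ B, b.card = 4)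
    {V : Type*} [AddCommGroup V] (htwo : ∀ v : V, v + v = 0) (e : Ω ≃ V)
    (M : Ω → Ω → Equiv.Perm Ω) (hM : ∀ x y, IsElemMove B x y (M x y))
    (he : ∀ x y z, e (M x y z) = e x + e y + e z) (s : Finset Ω) :
    s ∈ B ↔ (s.card = 4 ∧ ∑ p ∈ s, e p = 0) := by
  have hneg : ∀ v : V, -v = v := fun v => neg_eq_of_add_eq_zero_left (htwo v)
  have hcancel : ∀ u v : V, u + v = 0 → u = v := fun u v h => by
    rw [eq_neg_of_add_eq_zero_left h, hneg]
  have hline : ∀ {b x y z w}, b ∈ B → x ≠ y → z ≠ x → z ≠ y → w ≠ x → w ≠ y → w ≠ z →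
      x ∈ b → y ∈ b → z ∈ b → w ∈ b → e w = e x + e y + e z := by
    intro b x y z w hb hxy hzx hzy hwx hwy hwz hx hy hz hw
    obtain ⟨h, -⟩ | ⟨-, -, -, -, h⟩ := hM x y
    · exact absurd h hxy
    · rw [← he, (h z hzx hzy).2 b hb hx hy hz w hw hwx hwy hwz]
  constructor
  · intro hs
    refine ⟨hlines s hs, ?_⟩
    obtain ⟨x, y, z, w, hxy, hxz, hxw, hyz, hyw, hzw, rfl⟩ :=
      Finset.card_eq_four.mp (hlines s hs)
    rw [Finset.sum_insert (by simp [*]), Finset.sum_insert (by simp [*]), Finset.sum_pair hzw,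
      hline hs hxy hxz.symm hyz.symm hxw.symm hyw.symm hzw.symm (by simp) (by simp) (by simp)
        (by simp), ← htwo (e x + e y + e z)]
    abel
  · rintro ⟨hcard, hsum⟩
    obtain ⟨x, y, z, w, hxy, hxz, hxw, hyz, hyw, hzw, rfl⟩ := Finset.card_eq_four.mp hcard
    rw [Finset.sum_insert (by simp [*]), Finset.sum_insert (by simp [*]),
      Finset.sum_pair hzw] at hsum
    have hw : e w = e x + e y + e z := (hcancel _ _ (by rw [← hsum]; abel)).symm
    by_cases h : ∃ b ∈ B, x ∈ b ∧ y ∈ b ∧ z ∈ b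
    · obtain ⟨b, hb, hx, hy, hz⟩ := h
      have hthree : ({x, y, z} : Finset Ω).card = 3 := Finset.card_eq_three.mpr
        ⟨x, y, z, hxy, hxz, hyz, rfl⟩
      obtain ⟨v, hv, hv'⟩ := Finset.exists_mem_notMem_of_card_lt_card
        (s := ({x, y, z} : Finset Ω)) (t := b) (by rw [hthree, hlines b hb]; norm_num)
      simp only [Finset.mem_insert, Finset.mem_singleton, not_or] at hv'
      obtain rfl : v = w := e.injective <| by
        rw [hw, hline hb hxy hxz.symm hyz.symm hv'.1 hv'.2.1 hv'.2.2 hx hy hz hv]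
      convert hb
      refine Finset.eq_of_subset_of_card_le ?_ ?_
      · simp [Finset.insert_subset_iff, *]
      · rw [hcard, hlines b hb]
    · obtain ⟨h', -⟩ | ⟨-, -, -, -, h'⟩ := hM x y
      · exact absurd h' hxy
      · have hfix := (h' z hxz.symm hyz.symm).1 fun b hb hm => h ⟨b, hb, hm⟩
        have := he x y z
        rw [hfix, ← hw] at this
        exact absurd (e.injective this) hzw

/-- (Theorem B) For a simple pliable 4-hypergraph on at least four
points in which any two distinct points are collinear, all hole stabilizers are trivial
iff the hypergraph is (isomorphic to) a Boolean quadruple system of order `2^k`, `k ≥ 2`. -/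
theorem stmt4 (B : Finset (Finset Ω)) (hΩ : 4 ≤ Fintype.card Ω)
    (hlines : ∀ b ∈ B, b.card = 4) (hpl : HGPliable B)
    (hcol : ∀ x y : Ω, x ≠ y → ∃ b ∈ B, x ∈ b ∧ y ∈ b) :
    (∀ x : Ω, holeStab B x = {1}) ↔
      ∃ k : ℕ, 2 ≤ k ∧ ∃ e : Ω ≃ (Fin k → ZMod 2),
        ∀ s : Finset Ω, s ∈ B ↔ (s.card = 4 ∧ ∑ p ∈ s, e p = 0) := by
  have htwo : ∀ (k : ℕ) (v : Fin k → ZMod 2), v + v = 0 := fun k v =>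
    funext fun i => CharTwo.add_self_eq_zero (v i)
  constructor
  · intro hst
    have hne : Nonempty Ω := Fintype.card_pos_iff.mp (by omega)
    choose M hM using fun x y : Ω => hpl.exists_isElemMove hlines (x := x) (y := y)
      (or_iff_not_imp_left.mpr (hcol x y))
    obtain ⟨k, e, he⟩ := exists_equiv_of_holeStab_eq M hM hst
    refine ⟨k, ?_, e, mem_iff_of_isElemMove_apply hlines (htwo k) e M hM he⟩
    have hcard : Fintype.card Ω = 2 ^ k := by simp [Fintype.card_congr e]
    rw [hcard] at hΩ
    exact (Nat.pow_le_pow_iff_right (a := 2) (n := 2) one_lt_two).mp hΩ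
  · rintro ⟨k, -, e, he⟩
    exact holeStab_eq_of_boolean (htwo k) e he
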